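/- Let G be a graph, T a subgraph of G, and L a list assignment for G. Suppose G is T-critical with respect to L and that no proper subgraph H of G with T ⊆ H ⊊ G is T-critical with respect to L. Then every L-coloring of T that does not extend to an L-coloring of G extends to an L-coloring of every proper subgraph of G that contains T as a subgraph. -/

import Mathlib

open SimpleGraph

/-- `φ` is a proper `L`-coloring of the subgraph `H` of `G`. -/
def IsLColoring {V α : Type*} {G : SimpleGraph V} (H : G.Subgraph) (L : V → Set α)
    (φ : V → α) : Prop :=
  (∀ v ∈ H.verts, φ v ∈ L v) ∧ ∀ ⦃u v : V⦄, H.Adj u v → φ u ≠ φ v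

/-- The `L`-coloring `φ` of the subgraph `T` extends to an `L`-coloring of the subgraph `H`. -/
def ExtendsTo {V α : Type*} {G : SimpleGraph V} (T H : G.Subgraph) (L : V → Set α)
    (φ : V → α) : Prop :=
  ∃ ψ : V → α, IsLColoring H L ψ ∧ ∀ v ∈ T.verts, ψ v = φ v

/-- The subgraph `H` is `T`-critical with respect to the list assignment `L`:
`H ≠ T` and for every proper subgraph `H'` of `H` containing `T` there is an
`L`-coloring of `T` that extends to `H'` but not to `H`. -/
def IsCritical {V α : Type*} {G : SimpleGraph V} (H T : G.Subgraph) (L : V → Set α) : Prop :=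
  H ≠ T ∧ ∀ H' : G.Subgraph, T ≤ H' → H' < H →
    ∃ φ : V → α, IsLColoring T L φ ∧ ExtendsTo T H' L φ ∧ ¬ ExtendsTo T H L φ

/-- If `G` is `T`-critical with respect to `L` and no proper subgraph `H` of `G`
with `T ⊆ H ⊊ G` is `T`-critical with respect to `L`, then every `L`-coloring of `T` that does
not extend to an `L`-coloring of `G` extends to an `L`-coloring of every proper subgraph of `G`
containing `T`. -/
theorem stmt_5 {V α : Type*} [Fintype V] (G : SimpleGraph V) (T : G.Subgraph)
    (L : V → Set α)
    (hcrit : IsCritical (⊤ : G.Subgraph) T L)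
    (hmin : ∀ H : G.Subgraph, T ≤ H → H < ⊤ → ¬ IsCritical H T L) :
    ∀ φ : V → α, IsLColoring T L φ → ¬ ExtendsTo T (⊤ : G.Subgraph) L φ →
      ∀ H : G.Subgraph, T ≤ H → H < ⊤ → ExtendsTo T H L φ := by
  intro φ hφ _ H₀ hT₀ hlt₀
  by_contra hnot₀
  have hfin : {H : G.Subgraph | T ≤ H ∧ H < ⊤ ∧ ¬ ExtendsTo T H L φ}.Finite := Set.toFinite _
  obtain ⟨H, ⟨hTH, hHlt, hnot⟩, hHmin⟩ := hfin.exists_minimal ⟨H₀, hT₀, hlt₀, hnot₀⟩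
  refine hmin H hTH hHlt ⟨?_, fun H' hTH' hlt => ⟨φ, hφ, ?_, hnot⟩⟩
  · rintro rfl
    exact hnot ⟨φ, hφ, fun _ _ => rfl⟩
  · by_contra hnot'
    exact hlt.not_ge (hHmin ⟨hTH', hlt.trans hHlt, hnot'⟩ hlt.le)
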